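/- arXiv:1212.6100 — 2 statements merged into one kernel-verified Lean document; each statement's English description precedes it below -/
import Mathlib

section
/- There exists a constant C₅ > 0 such that for every s > 0 and every f ∈ C_b^∞(ℝ^d) with μ_V(f) = 0, the weak Poincaré inequality μ_V(f²) ≤ C₅ α₁(s) · 𝓔_{α,V}(f,f) + s ‖f‖_∞² holds, where α₁(s) := inf{ r^{3d} K(r)/k(r) : r > 1 and μ_V(ℝ^d ∖ B(0,r)) ≤ s/(1+s) }. -/
open MeasureTheory Real Set Metric Filter

noncomputable section

/-- Euclidean space `ℝ^d`. -/
abbrev Ed (d : ℕ) := EuclideanSpace ℝ (Fin d)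

/-- The probability measure `μ_V(dx) = C_V e^{-V(x)} dx` with `C_V = (∫ e^{-V})⁻¹`. -/
def muV (d : ℕ) (V : Ed d → ℝ) : Measure (Ed d) :=
  (volume : Measure (Ed d)).withDensity
    fun x => ENNReal.ofReal ((∫ y, Real.exp (-V y))⁻¹ * Real.exp (-V x))

/-- `f ∈ C_b^∞(ℝ^d)`: smooth with bounded derivatives of every order. -/
def CbSmooth (d : ℕ) (f : Ed d → ℝ) : Prop :=
  ContDiff ℝ (⊤ : ℕ∞) f ∧ ∀ n : ℕ, ∃ C : ℝ, ∀ x, ‖iteratedFDeriv ℝ n f x‖ ≤ C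

/-- `V` is locally bounded. -/
def LocallyBounded (d : ℕ) (V : Ed d → ℝ) : Prop :=
  ∀ r : ℝ, ∃ M : ℝ, ∀ x : Ed d, ‖x‖ ≤ r → |V x| ≤ M

/-- The nonlocal Dirichlet form with finite range jumps `𝓔_{α,V}`. -/
def formE (d : ℕ) (α : ℝ) (V f : Ed d → ℝ) : ℝ :=
  (1/2) * ∫ x, (∫ y in {y : Ed d | dist x y ≤ 1},
      (f x - f y) ^ 2 / dist x y ^ ((d : ℝ) + α)) ∂(muV d V)

/-- The nonlocal Dirichlet form with large jumps `𝓓_{α,V}`. -/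
def formD (d : ℕ) (α : ℝ) (V f : Ed d → ℝ) : ℝ :=
  (1/2) * ∫ x, (∫ y in {y : Ed d | 1 < dist x y},
      (f x - f y) ^ 2 / dist x y ^ ((d : ℝ) + α)) ∂(muV d V)

/-- `inf_{z : |x|-1 ≤ |z| ≤ |x|-1/2} e^{-V(z)}`. -/
def infAnn (d : ℕ) (V : Ed d → ℝ) (x : Ed d) : ℝ :=
  sInf ((fun z => Real.exp (-V z)) '' {z : Ed d | ‖x‖ - 1 ≤ ‖z‖ ∧ ‖z‖ ≤ ‖x‖ - 1/2})

/-- `sup_{z : |x| ≤ |z| ≤ |x|+1} e^{-V(z)}`. -/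
def supAnn (d : ℕ) (V : Ed d → ℝ) (x : Ed d) : ℝ :=
  sSup ((fun z => Real.exp (-V z)) '' {z : Ed d | ‖x‖ ≤ ‖z‖ ∧ ‖z‖ ≤ ‖x‖ + 1})

/-- `K(r) = sup_{|x| ≤ r} e^{-V(x)}`. -/
def Kfun (d : ℕ) (V : Ed d → ℝ) (r : ℝ) : ℝ :=
  sSup ((fun x => Real.exp (-V x)) '' {x : Ed d | ‖x‖ ≤ r})

/-- `k(r) = inf_{|x| ≤ r+1} e^{-V(x)}`. -/
def kfun (d : ℕ) (V : Ed d → ℝ) (r : ℝ) : ℝ :=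
  sInf ((fun x => Real.exp (-V x)) '' {x : Ed d | ‖x‖ ≤ r + 1})

/-- The constant `(1/α)·2^{2d+1}·(e + e^{1/2})·(2^α − 1)`. -/
def thresholdConst (d : ℕ) (α : ℝ) : ℝ :=
  (1/α) * (2:ℝ) ^ (2*d+1) * (Real.exp 1 + Real.exp (1/2)) * ((2:ℝ) ^ α - 1)

/-- `α₁(s) = inf { r^{3d} K(r)/k(r) : r > 1, μ_V(B(0,r)ᶜ) ≤ s/(1+s) }`. -/
def alpha1 (d : ℕ) (V : Ed d → ℝ) (s : ℝ) : ℝ :=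
  sInf ((fun r : ℝ => r ^ (3*d) * Kfun d V r / kfun d V r) ''
    {r : ℝ | 1 < r ∧ muV d V ((ball (0 : Ed d) r)ᶜ) ≤ ENNReal.ofReal (s/(1+s))})

open scoped ENNReal

theorem setLIntegral_sq_translate_le {E : Type*} [NormedAddCommGroup E] [NormedSpace ℝ E]
    [MeasurableSpace E] [BorelSpace E] (μ : Measure E) [μ.IsAddRightInvariant]
    {f : E → ℝ} (hf : Continuous f) {S : Set E} (hS : Convex ℝ S) (hSm : MeasurableSet S)
    (h : E) {N : ℕ} (hN : 0 < N) :
    ∫⁻ x in S ∩ (· + h) ⁻¹' S, ENNReal.ofReal ((f x - f (x + h)) ^ 2) ∂μ ≤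
      (N : ℝ≥0∞) ^ 2 * ∫⁻ u in S, ENNReal.ofReal ((f u - f (u + (N : ℝ)⁻¹ • h)) ^ 2) ∂μ := by
  have hN' : (0 : ℝ) < N := by exact_mod_cast hN
  set p : ℕ → E → E := fun i x => x + ((i : ℝ) / N) • h with hp
  have hp_succ (i : ℕ) (x : E) : p (i + 1) x = p i x + (N : ℝ)⁻¹ • h := by
    simp only [hp, add_assoc, ← add_smul]
    congr 2
    push_cast
    field_simp
  have htel (x : E) : f x - f (x + h) = ∑ i ∈ Finset.range N, (f (p i x) - f (p (i + 1) x)) := by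
    rw [Finset.sum_range_sub' (fun i => f (p i x))]
    simp [hp, hN'.ne']
  have hle (x : E) : ENNReal.ofReal ((f x - f (x + h)) ^ 2) ≤
      ∑ i ∈ Finset.range N, (N : ℝ≥0∞) *
        ENNReal.ofReal ((f (p i x) - f (p i x + (N : ℝ)⁻¹ • h)) ^ 2) := by
    rw [htel, ← Finset.mul_sum, ← ENNReal.ofReal_sum_of_nonneg (fun _ _ => sq_nonneg _),
      ← ENNReal.ofReal_natCast, ← ENNReal.ofReal_mul (by positivity)]
    refine ENNReal.ofReal_le_ofReal ?_
    simpa [hp_succ] using sq_sum_le_card_mul_sum_sq (s := Finset.range N)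
      (f := fun i => f (p i x) - f (p (i + 1) x))
  set g : E → ℝ≥0∞ := fun u => ENNReal.ofReal ((f u - f (u + (N : ℝ)⁻¹ • h)) ^ 2)
  have hgm : Measurable g := by
    have : Continuous fun u => (f u - f (u + (N : ℝ)⁻¹ • h)) ^ 2 := by fun_prop
    exact this.measurable.ennreal_ofReal
  have hpm (i : ℕ) : MeasurePreserving (p i) μ μ := measurePreserving_add_right μ _
  have hstep (i : ℕ) (hi : i ∈ Finset.range N) :
      ∫⁻ x in S ∩ (· + h) ⁻¹' S, (N : ℝ≥0∞) * g (p i x) ∂μ ≤ N * ∫⁻ u in S, g u ∂μ := by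
    rw [lintegral_const_mul (f := fun x => g (p i x)) _ (hgm.comp (hpm i).measurable),
      ← (hpm i).setLIntegral_comp_preimage hSm hgm]
    gcongr
    rintro x ⟨hx, hxh⟩
    have hi' : (i : ℝ) < N := by exact_mod_cast Finset.mem_range.1 hi
    exact hS.add_smul_mem hx hxh ⟨by positivity, (div_le_one hN').2 hi'.le⟩
  calc
    _ ≤ ∫⁻ x in S ∩ (· + h) ⁻¹' S, ∑ i ∈ Finset.range N, (N : ℝ≥0∞) * g (p i x) ∂μ :=
      lintegral_mono hle
    _ = ∑ i ∈ Finset.range N, ∫⁻ x in S ∩ (· + h) ⁻¹' S, (N : ℝ≥0∞) * g (p i x) ∂μ :=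
      lintegral_finsetSum _ fun i _ => (hgm.comp (hpm i).measurable).const_mul _
    _ ≤ ∑ i ∈ Finset.range N, N * ∫⁻ u in S, g u ∂μ := Finset.sum_le_sum hstep
    _ = _ := by
      rw [Finset.sum_const, Finset.card_range, nsmul_eq_mul, ← mul_assoc, sq]

theorem lintegral_comp_inv_smul {E : Type*} [NormedAddCommGroup E] [NormedSpace ℝ E]
    [FiniteDimensional ℝ E] [MeasurableSpace E] [BorelSpace E] (μ : Measure E)
    [μ.IsAddHaarMeasure] {g : E → ℝ≥0∞} (hg : Measurable g) {N : ℕ} (hN : 0 < N) :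
    ∫⁻ h, g ((N : ℝ)⁻¹ • h) ∂μ = (N : ℝ≥0∞) ^ Module.finrank ℝ E * ∫⁻ z, g z ∂μ := by
  have hN' : (0 : ℝ) < N := by exact_mod_cast hN
  rw [← lintegral_map hg (measurable_const_smul _),
    Measure.map_addHaar_smul μ (inv_ne_zero hN'.ne'), lintegral_smul_measure, smul_eq_mul]
  congr 1
  rw [inv_pow, inv_inv, abs_of_pos (by positivity), ENNReal.ofReal_pow hN'.le,
    ENNReal.ofReal_natCast]

theorem lintegral_ball_sq_sub_le {E : Type*} [NormedAddCommGroup E] [NormedSpace ℝ E]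
    [FiniteDimensional ℝ E] [MeasurableSpace E] [BorelSpace E] (μ : Measure E)
    [μ.IsAddHaarMeasure] {f : E → ℝ} (hf : Continuous f) (c : E) {r : ℝ} {N : ℕ} (hN : 0 < N)
    (hr : 2 * r ≤ N) :
    ∫⁻ x in ball c r, ∫⁻ y in ball c r, ENNReal.ofReal ((f x - f y) ^ 2) ∂μ ∂μ ≤
      (N : ℝ≥0∞) ^ (Module.finrank ℝ E + 2) *
        ∫⁻ x in ball c r, ∫⁻ y in closedBall x 1, ENNReal.ofReal ((f x - f y) ^ 2) ∂μ ∂μ := by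
  have hN' : (0 : ℝ) < N := by exact_mod_cast hN
  set B := ball c r with hB
  have hBm : MeasurableSet B := measurableSet_ball
  set G : E → E → ℝ≥0∞ := fun x h => ENNReal.ofReal ((f x - f (x + h)) ^ 2)
  have hGm : Measurable (Function.uncurry G) := by
    have : Continuous fun p : E × E => (f p.1 - f (p.1 + p.2)) ^ 2 := by fun_prop
    exact this.measurable.ennreal_ofReal
  have hshift (T : E → Set E) (hT : ∀ x, MeasurableSet (T x)) (x : E) :
      ∫⁻ y in T x, ENNReal.ofReal ((f x - f y) ^ 2) ∂μ =
        ∫⁻ h in (x + ·) ⁻¹' T x, G x h ∂μ :=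
    ((measurePreserving_add_left μ x).setLIntegral_comp_preimage (hT x)
      (by have : Continuous fun y => (f x - f y) ^ 2 := by fun_prop
          exact this.measurable.ennreal_ofReal)).symm
  set Φ : E → ℝ≥0∞ := fun z => ∫⁻ u in B, G u z ∂μ
  have hΦm : Measurable Φ := hGm.lintegral_prod_left'
  calc
    _ = ∫⁻ x in B, ∫⁻ h, ((fun p : E × E => p.1 + p.2) ⁻¹' B).indicator
          (Function.uncurry G) (x, h) ∂μ ∂μ := by
      refine lintegral_congr fun x => ?_
      rw [hshift (fun _ => B) (fun _ => hBm) x,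
        ← lintegral_indicator ((measurable_const_add x) hBm)]
      rfl
    _ = ∫⁻ h, ∫⁻ x in B, ((fun p : E × E => p.1 + p.2) ⁻¹' B).indicator
          (Function.uncurry G) (x, h) ∂μ ∂μ :=
      lintegral_lintegral_swap
        (hGm.indicator ((measurable_fst.add measurable_snd) hBm)).aemeasurable
    _ = ∫⁻ h, ∫⁻ x in B ∩ (· + h) ⁻¹' B, G x h ∂μ ∂μ := by
      refine lintegral_congr fun h => ?_
      rw [inter_comm, ← Measure.restrict_restrict ((measurable_add_const h) hBm),
        ← lintegral_indicator ((measurable_add_const h) hBm)]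
      rfl
    _ ≤ ∫⁻ h, (N : ℝ≥0∞) ^ 2 * (closedBall 0 1).indicator Φ ((N : ℝ)⁻¹ • h) ∂μ := by
      refine lintegral_mono fun h => ?_
      by_cases hh : (N : ℝ)⁻¹ • h ∈ closedBall (0 : E) 1
      · rw [indicator_of_mem hh]
        exact setLIntegral_sq_translate_le μ hf (convex_ball c r) hBm h hN
      · suffices B ∩ (· + h) ⁻¹' B = ∅ by simp [this]
        refine eq_empty_of_forall_notMem fun x ⟨hx, hxh⟩ => hh ?_
        have h1 : ‖h‖ < 2 * r := by
          have := dist_triangle_right (x + h) x c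
          rw [dist_self_add_left] at this
          have h2 : dist x c < r := hx
          have h3 : dist (x + h) c < r := hxh
          linarith
        rw [mem_closedBall_zero_iff, norm_smul, norm_inv, Real.norm_natCast, inv_mul_le_one₀ hN']
        linarith
    _ = (N : ℝ≥0∞) ^ (Module.finrank ℝ E + 2) * ∫⁻ z in closedBall 0 1, Φ z ∂μ := by
      have := hΦm.indicator (measurableSet_closedBall (x := (0 : E)) (ε := 1))
      rw [lintegral_const_mul (f := fun h => (closedBall 0 1).indicator Φ ((N : ℝ)⁻¹ • h)) _
          (this.comp (measurable_const_smul _)),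
        lintegral_comp_inv_smul μ this hN, lintegral_indicator measurableSet_closedBall]
      ring
    _ = _ := by
      congr 1
      rw [← lintegral_lintegral_swap hGm.aemeasurable]
      refine lintegral_congr fun x => ?_
      rw [hshift (fun x => closedBall x 1) (fun _ => measurableSet_closedBall) x]
      congr 2
      ext h
      simp

theorem integrableOn_norm_rpow_closedBall {E : Type*} [NormedAddCommGroup E] [NormedSpace ℝ E]
    [FiniteDimensional ℝ E] [Nontrivial E] [MeasurableSpace E] [BorelSpace E] (μ : Measure E)
    [μ.IsAddHaarMeasure] {p : ℝ} (hp : -(Module.finrank ℝ E : ℝ) < p) (R : ℝ) :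
    IntegrableOn (fun x : E => ‖x‖ ^ p) (closedBall 0 R) μ := by
  refine IntegrableOn.mono_set ?_ (closedBall_subset_ball (lt_add_one R))
  rw [integrableOn_fun_norm_addHaar μ (f := fun t : ℝ => t ^ p)]
  have hpos : 1 ≤ Module.finrank ℝ E := Module.finrank_pos
  have hint : IntegrableOn (fun t : ℝ => t ^ (p + Module.finrank ℝ E - 1)) (Ioo 0 (R + 1)) := by
    rcases le_or_gt (R + 1) 0 with hR | hR
    · simp [Ioo_eq_empty hR.not_gt]
    · exact ((intervalIntegrable_iff_integrableOn_Ioo_of_le hR.le).1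
        (intervalIntegral.intervalIntegrable_rpow' (by linarith)))
  refine hint.congr_fun (fun t ht => ?_) measurableSet_Ioo
  rw [smul_eq_mul, ← Real.rpow_natCast, ← Real.rpow_add ht.1, Nat.cast_sub hpos]
  exact congrArg (t ^ ·) (by push_cast; ring)

theorem isProbabilityMeasure_muV {d : ℕ} {V : Ed d → ℝ}
    (hVint : Integrable (fun x => Real.exp (-V x))) : IsProbabilityMeasure (muV d V) := by
  have hpos : 0 < ∫ y, Real.exp (-V y) := integral_exp_pos hVint
  refine ⟨?_⟩
  rw [muV, withDensity_apply _ MeasurableSet.univ, Measure.restrict_univ,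
    ← ofReal_integral_eq_lintegral_ofReal (hVint.const_mul _)
      (ae_of_all _ fun x => by positivity), integral_const_mul, inv_mul_cancel₀ hpos.ne',
    ENNReal.ofReal_one]

theorem CbSmooth.continuous {d : ℕ} {f : Ed d → ℝ} (hf : CbSmooth d f) : Continuous f :=
  hf.1.continuous

theorem CbSmooth.bddAbove_abs {d : ℕ} {f : Ed d → ℝ} (hf : CbSmooth d f) :
    BddAbove (range fun x => |f x|) := by
  obtain ⟨C, hC⟩ := hf.2 0
  refine ⟨C, ?_⟩
  rintro _ ⟨x, rfl⟩
  simpa using hC x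

theorem CbSmooth.exists_sq_sub_le {d : ℕ} {f : Ed d → ℝ} (hf : CbSmooth d f) :
    ∃ L : ℝ, ∀ x y, (f x - f y) ^ 2 ≤ L * dist x y ^ 2 := by
  obtain ⟨C, hC⟩ := hf.2 1
  refine ⟨C ^ 2, fun x y => ?_⟩
  have h : ‖f x - f y‖ ≤ C * ‖x - y‖ :=
    convex_univ.norm_image_sub_le_of_norm_fderiv_le (𝕜 := ℝ)
      (fun z _ => (hf.1.differentiable (by simp)).differentiableAt)
      (fun z _ => by simpa only [norm_iteratedFDeriv_one] using hC z) (mem_univ y) (mem_univ x)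
  rw [dist_eq_norm, ← mul_pow, ← sq_abs, ← Real.norm_eq_abs]
  gcongr

/-- The energy density of `𝓔_{α,V}` as an extended nonnegative function. -/
def jumpDensity (d : ℕ) (α : ℝ) (f : Ed d → ℝ) (x : Ed d) : ℝ≥0∞ :=
  ∫⁻ y in closedBall x 1, ENNReal.ofReal ((f x - f y) ^ 2 / dist x y ^ ((d : ℝ) + α))

theorem measurable_jumpDensity {d : ℕ} {α : ℝ} {f : Ed d → ℝ} (hf : Continuous f) :
    Measurable (jumpDensity d α f) := by
  have hm : Measurable fun p : Ed d × Ed d =>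
      ENNReal.ofReal ((f p.1 - f p.2) ^ 2 / dist p.1 p.2 ^ ((d : ℝ) + α)) := by
    have := hf.measurable
    fun_prop
  have hs : MeasurableSet {p : Ed d × Ed d | dist p.2 p.1 ≤ 1} :=
    measurableSet_le (by fun_prop) measurable_const
  have := (hm.indicator hs).lintegral_prod_right' (ν := (volume : Measure (Ed d)))
  convert this using 2 with x
  rw [jumpDensity, ← lintegral_indicator measurableSet_closedBall]
  rfl

theorem exists_jumpDensity_le {d : ℕ} (hd : 1 ≤ d) {α : ℝ} (hα : α < 2)
    {f : Ed d → ℝ} (hf : CbSmooth d f) :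
    ∃ C : ℝ≥0∞, C ≠ ∞ ∧ ∀ x, jumpDensity d α f x ≤ C := by
  obtain ⟨L, hL⟩ := hf.exists_sq_sub_le
  have : NeZero d := ⟨by omega⟩
  set g : Ed d → ℝ≥0∞ := fun z => ENNReal.ofReal (L * ‖z‖ ^ (2 - ((d : ℝ) + α)))
  have hint : IntegrableOn (fun z : Ed d => L * ‖z‖ ^ (2 - ((d : ℝ) + α))) (closedBall 0 1) :=
    (integrableOn_norm_rpow_closedBall volume (by simp; linarith) 1).const_mul L
  refine ⟨∫⁻ z in closedBall 0 1, g z, ?_, fun x => ?_⟩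
  · exact (hint.lintegral_lt_top).ne
  · have hg : Measurable g := by fun_prop
    rw [← (measurePreserving_sub_right volume x).setLIntegral_comp_preimage
      measurableSet_closedBall hg]
    have hpre : (fun y => y - x) ⁻¹' closedBall 0 1 = closedBall x 1 := by
      ext y
      simp [dist_eq_norm]
    rw [hpre]
    refine lintegral_mono fun y => ENNReal.ofReal_le_ofReal ?_
    rcases eq_or_ne y x with rfl | hxy
    · have := hL y (y + EuclideanSpace.single 0 1)
      have hL0 : 0 ≤ L := by
        refine (sq_nonneg _).trans this |>.trans_eq ?_
        simp [dist_eq_norm]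
      simp
      positivity
    · have hpos : 0 < dist x y := dist_pos.2 hxy.symm
      rw [← dist_eq_norm, dist_comm y x, Real.rpow_sub hpos, Real.rpow_two, ← mul_div_assoc]
      gcongr
      exact hL x y

theorem ofReal_two_mul_formE {d : ℕ} (hd : 1 ≤ d) {α : ℝ} (hα : α < 2) {V f : Ed d → ℝ}
    (hVint : Integrable (fun x => Real.exp (-V x))) (hf : CbSmooth d f) :
    ENNReal.ofReal (2 * formE d α V f) = ∫⁻ x, jumpDensity d α f x ∂(muV d V) := by
  obtain ⟨C, hC, hle⟩ := exists_jumpDensity_le hd hα hf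
  have := isProbabilityMeasure_muV hVint
  have hinner (x : Ed d) : ∫ y in {y : Ed d | dist x y ≤ 1},
      (f x - f y) ^ 2 / dist x y ^ ((d : ℝ) + α) = (jumpDensity d α f x).toReal := by
    have hset : {y : Ed d | dist x y ≤ 1} = closedBall x 1 := by
      ext y
      simp [dist_comm]
    have hm := hf.continuous.measurable
    have hgm : Measurable fun y => (f x - f y) ^ 2 / dist x y ^ ((d : ℝ) + α) := by fun_prop
    rw [hset, integral_eq_lintegral_of_nonneg_ae (ae_of_all _ fun y => by positivity)
      hgm.aestronglyMeasurable, jumpDensity]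
  rw [formE, ← mul_assoc, mul_one_div_cancel two_ne_zero, one_mul]
  simp_rw [hinner]
  rw [integral_toReal (measurable_jumpDensity hf.continuous).aemeasurable
    (ae_of_all _ fun x => (hle x).trans_lt hC.lt_top), ENNReal.ofReal_toReal]
  refine ne_top_of_le_ne_top hC ((lintegral_mono hle).trans ?_)
  simp

theorem formE_nonneg (d : ℕ) (α : ℝ) (V f : Ed d → ℝ) : 0 ≤ formE d α V f :=
  mul_nonneg (by norm_num) <| integral_nonneg fun _ => integral_nonneg fun _ => by positivity

theorem lintegral_closedBall_sq_sub_le_jumpDensity {d : ℕ} {α : ℝ} (hα : 0 < α) (f : Ed d → ℝ)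
    (x : Ed d) :
    ∫⁻ y in closedBall x 1, ENNReal.ofReal ((f x - f y) ^ 2) ≤ jumpDensity d α f x := by
  refine setLIntegral_mono' measurableSet_closedBall fun y hy => ENNReal.ofReal_le_ofReal ?_
  rw [mem_closedBall, dist_comm] at hy
  rcases eq_or_ne x y with rfl | hxy
  · simp
  · exact le_div_self (sq_nonneg _) (Real.rpow_pos_of_pos (dist_pos.2 hxy) _)
      (Real.rpow_le_one dist_nonneg hy (by positivity))

theorem LocallyBounded.exp_neg_le_Kfun {d : ℕ} {V : Ed d → ℝ} (hV : LocallyBounded d V) {r : ℝ}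
    {x : Ed d} (hx : ‖x‖ ≤ r) : Real.exp (-V x) ≤ Kfun d V r := by
  obtain ⟨M, hM⟩ := hV r
  refine le_csSup ⟨Real.exp M, ?_⟩ (mem_image_of_mem _ hx)
  rintro _ ⟨y, hy, rfl⟩
  exact Real.exp_le_exp.2 (by linarith [(abs_le.1 (hM y hy)).1])

theorem kfun_le_exp_neg {d : ℕ} {V : Ed d → ℝ} {r : ℝ} {x : Ed d} (hx : ‖x‖ ≤ r + 1) :
    kfun d V r ≤ Real.exp (-V x) := by
  refine csInf_le ⟨0, ?_⟩ (mem_image_of_mem _ hx)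
  rintro _ ⟨y, -, rfl⟩
  positivity

theorem LocallyBounded.kfun_pos {d : ℕ} {V : Ed d → ℝ} (hV : LocallyBounded d V) {r : ℝ}
    (hr : 0 ≤ r) : 0 < kfun d V r := by
  obtain ⟨M, hM⟩ := hV (r + 1)
  refine (Real.exp_pos (-M)).trans_le (le_csInf ⟨_, mem_image_of_mem _ (x := 0) ?_⟩ ?_)
  · simp only [mem_ofPred_eq, norm_zero]
    positivity
  · rintro _ ⟨y, hy, rfl⟩
    exact Real.exp_le_exp.2 (by linarith [(abs_le.1 (hM y hy)).2])

theorem LocallyBounded.Kfun_pos {d : ℕ} {V : Ed d → ℝ} (hV : LocallyBounded d V) {r : ℝ}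
    (hr : 0 ≤ r) : 0 < Kfun d V r :=
  (Real.exp_pos _).trans_le (hV.exp_neg_le_Kfun (x := 0) (by simpa using hr))

theorem kfun_mul_lintegral_le {d : ℕ} (hd : 1 ≤ d) {α : ℝ} (hα : 0 < α ∧ α < 2)
    {V f : Ed d → ℝ} (hVmeas : Measurable V)
    (hVint : Integrable (fun x => Real.exp (-V x))) (hf : CbSmooth d f) (r : ℝ) :
    ENNReal.ofReal ((∫ y, Real.exp (-V y))⁻¹ * kfun d V r) *
        ∫⁻ x in ball 0 r, ∫⁻ y in closedBall x 1, ENNReal.ofReal ((f x - f y) ^ 2) ≤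
      ENNReal.ofReal (2 * formE d α V f) := by
  have hpos : 0 < ∫ y, Real.exp (-V y) := integral_exp_pos hVint
  have hjm := measurable_jumpDensity (α := α) hf.continuous
  rw [ofReal_two_mul_formE hd hα.2 hVint hf]
  calc
    _ ≤ ENNReal.ofReal ((∫ y, Real.exp (-V y))⁻¹ * kfun d V r) *
          ∫⁻ x in ball 0 r, jumpDensity d α f x := by
      gcongr with x
      exact lintegral_closedBall_sq_sub_le_jumpDensity hα.1 f x
    _ = ∫⁻ x in ball 0 r, ENNReal.ofReal ((∫ y, Real.exp (-V y))⁻¹ * kfun d V r) *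
          jumpDensity d α f x := (lintegral_const_mul _ hjm).symm
    _ ≤ ∫⁻ x in ball 0 r, ENNReal.ofReal ((∫ y, Real.exp (-V y))⁻¹ * Real.exp (-V x)) *
          jumpDensity d α f x := by
      refine setLIntegral_mono' measurableSet_ball fun x hx => ?_
      rw [mem_ball_zero_iff] at hx
      gcongr
      exact kfun_le_exp_neg (by linarith)
    _ = ∫⁻ x in ball 0 r, jumpDensity d α f x ∂(muV d V) := by
      rw [muV, setLIntegral_withDensity_eq_setLIntegral_mul _ (by fun_prop) hjm measurableSet_ball]
      rfl
    _ ≤ _ := setLIntegral_le_lintegral _ _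

theorem setLIntegral_muV_le {d : ℕ} {V : Ed d → ℝ} (hVmeas : Measurable V)
    (hVloc : LocallyBounded d V) {g : Ed d → ℝ≥0∞} (hg : Measurable g) (r : ℝ) :
    ∫⁻ x in ball 0 r, g x ∂(muV d V) ≤
      ENNReal.ofReal ((∫ y, Real.exp (-V y))⁻¹ * Kfun d V r) * ∫⁻ x in ball 0 r, g x := by
  have hpos : 0 ≤ ∫ y, Real.exp (-V y) := integral_nonneg fun _ => (Real.exp_pos _).le
  rw [muV, setLIntegral_withDensity_eq_setLIntegral_mul _ (by fun_prop) hg measurableSet_ball,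
    ← lintegral_const_mul _ hg]
  refine setLIntegral_mono' measurableSet_ball fun x hx => ?_
  rw [mem_ball_zero_iff] at hx
  simp only [Pi.mul_apply]
  gcongr
  exact hVloc.exp_neg_le_Kfun hx.le

theorem exists_setIntegral_sq_sub_le {d : ℕ} (hd : 1 ≤ d) {α : ℝ} (hα : 0 < α ∧ α < 2)
    {V f : Ed d → ℝ} (hVmeas : Measurable V) (hVloc : LocallyBounded d V)
    (hVint : Integrable (fun x => Real.exp (-V x))) (hf : CbSmooth d f) {r : ℝ} (hr : 1 < r) :
    ∃ m : ℝ, ∫ x in ball 0 r, (f x - m) ^ 2 ∂(muV d V) ≤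
      2 * 3 ^ (d + 2) / volume.real (ball (0 : Ed d) 1) *
        (r ^ (3 * d) * Kfun d V r / kfun d V r) * formE d α V f := by
  have hr0 : 0 < r := by linarith
  have hfm := hf.continuous.measurable
  set c : ℝ := (∫ y, Real.exp (-V y))⁻¹
  have hc : 0 < c := inv_pos.2 (integral_exp_pos hVint)
  have hk := hVloc.kfun_pos hr0.le
  have hK := hVloc.Kfun_pos hr0.le
  have hE := formE_nonneg d α V f
  set B : Set (Ed d) := ball 0 r with hB
  have hv1 : 0 < volume.real (ball (0 : Ed d) 1) :=
    ENNReal.toReal_pos (measure_ball_pos _ _ one_pos).ne' measure_ball_lt_top.ne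
  have hvB : volume.real B = r ^ d * volume.real (ball (0 : Ed d) 1) := by
    rw [measureReal_def, hB, Measure.addHaar_ball_of_pos _ _ hr0, ENNReal.toReal_mul,
      ENNReal.toReal_ofReal (by positivity), finrank_euclideanSpace_fin, measureReal_def]
  set N : ℕ := ⌈2 * r⌉₊
  have hN2 : 2 * r ≤ N := Nat.le_ceil _
  have hN3 : (N : ℝ) ≤ 3 * r := by
    have := Nat.ceil_lt_add_one (a := 2 * r) (by positivity)
    linarith
  have hN0 : 0 < N := Nat.ceil_pos.2 (by positivity)
  have hNpow : (N : ℝ) ^ (d + 2) ≤ 3 ^ (d + 2) * (r ^ (3 * d) * r ^ d) := by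
    rw [← pow_add]
    calc (N : ℝ) ^ (d + 2) ≤ (3 * r) ^ (d + 2) := by gcongr
      _ = 3 ^ (d + 2) * r ^ (d + 2) := mul_pow _ _ _
      _ ≤ _ := mul_le_mul_of_nonneg_left (pow_le_pow_right₀ hr.le (by omega)) (by positivity)
  set I : ℝ≥0∞ := ∫⁻ x in B, ∫⁻ y in closedBall x 1, ENNReal.ofReal ((f x - f y) ^ 2)
  have hIle : ENNReal.ofReal (c * kfun d V r) * I ≤ ENNReal.ofReal (2 * formE d α V f) :=
    kfun_mul_lintegral_le hd hα hVmeas hVint hf r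
  have hIfin : I ≠ ∞ := by
    intro h
    rw [h, ENNReal.mul_top (by simpa using by positivity)] at hIle
    exact ENNReal.ofReal_ne_top (top_le_iff.1 hIle)
  have hIreal : I.toReal ≤ 2 * formE d α V f / (c * kfun d V r) := by
    have := ENNReal.toReal_mono ENNReal.ofReal_ne_top hIle
    rw [ENNReal.toReal_mul, ENNReal.toReal_ofReal (by positivity),
      ENNReal.toReal_ofReal (by positivity)] at this
    rwa [le_div_iff₀' (by positivity)]
  have hGm : Measurable fun p : Ed d × Ed d => ENNReal.ofReal ((f p.1 - f p.2) ^ 2) := by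
    fun_prop
  obtain ⟨y, -, hy⟩ := exists_le_setLAverage (μ := volume) (s := B)
    (f := fun y => ∫⁻ x in B, ENNReal.ofReal ((f y - f x) ^ 2))
    (measure_ball_pos _ _ hr0).ne' measure_ball_lt_top.ne hGm.lintegral_prod_right'.aemeasurable
  have hD := lintegral_ball_sq_sub_le volume hf.continuous 0 hN0 hN2
  rw [finrank_euclideanSpace_fin] at hD
  rw [setLAverage_eq] at hy
  have hX := hy.trans (ENNReal.div_le_div_right hD _)
  have hBne : volume B ≠ 0 := (measure_ball_pos _ _ hr0).ne'
  have hgm : Measurable fun x => ENNReal.ofReal ((f y - f x) ^ 2) := by fun_prop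
  have hmu := (setLIntegral_muV_le hVmeas hVloc hgm r).trans (mul_le_mul_right hX _)
  refine ⟨f y, ?_⟩
  rw [integral_eq_lintegral_of_nonneg_ae (ae_of_all _ fun y => by positivity)
    (by fun_prop)]
  simp_rw [sub_sq_comm _ (f y)]
  have hfin : ENNReal.ofReal (c * Kfun d V r) * ((N : ℝ≥0∞) ^ (d + 2) * I / volume B) ≠ ∞ := by
    refine ENNReal.mul_ne_top ENNReal.ofReal_ne_top
      (ENNReal.div_ne_top (ENNReal.mul_ne_top ?_ hIfin) hBne)
    exact ENNReal.pow_ne_top (ENNReal.natCast_ne_top N)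
  refine (ENNReal.toReal_mono hfin hmu).trans ?_
  rw [ENNReal.toReal_mul, ENNReal.toReal_div, ENNReal.toReal_mul, ENNReal.toReal_pow,
    ENNReal.toReal_natCast, ENNReal.toReal_ofReal (by positivity), ← measureReal_def, hvB]
  calc
    _ ≤ c * Kfun d V r * (3 ^ (d + 2) * (r ^ (3 * d) * r ^ d) *
          (2 * formE d α V f / (c * kfun d V r)) /
          (r ^ d * volume.real (ball (0 : Ed d) 1))) := by
      gcongr
    _ = _ := by
      field_simp

theorem integral_sq_le_setIntegral_sq_sub_add {Ω : Type*} [MeasurableSpace Ω] {μ : Measure Ω}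
    [IsProbabilityMeasure μ] {f : Ω → ℝ} (hf : Measurable f) {M : ℝ} (hM : ∀ x, |f x| ≤ M)
    (hmean : ∫ x, f x ∂μ = 0) {S : Set Ω} (hS : MeasurableSet S) {s : ℝ} (hs : 0 < s)
    (hSs : μ.real Sᶜ ≤ s / (1 + s)) (m : ℝ) :
    ∫ x, f x ^ 2 ∂μ ≤ ∫ x in S, (f x - m) ^ 2 ∂μ + s * M ^ 2 := by
  have hfi : Integrable f μ := Integrable.of_bound hf.aestronglyMeasurable M (ae_of_all _ hM)
  have hf2 : Integrable (fun x => f x ^ 2) μ :=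
    Integrable.of_bound (by fun_prop) (M ^ 2) (ae_of_all _ fun x => by
      rw [norm_pow]
      exact pow_le_pow_left₀ (norm_nonneg _) (hM x) 2)
  set q := μ.real Sᶜ
  have hp : μ.real S = 1 - q := by
    have := probReal_add_probReal_compl (μ := μ) hS
    linarith
  have hq0 : 0 ≤ q := measureReal_nonneg
  have hp0 : 0 < 1 - q := by
    have : s / (1 + s) < 1 := (div_lt_one (by positivity)).2 (by linarith)
    linarith
  have hqs : q ≤ s * (1 - q) := by
    rw [le_div_iff₀ (by positivity)] at hSs
    linarith
  set a := ∫ x in S, f x ∂μ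
  have ha_compl : |a| ≤ M * q := by
    have h1 : a = -∫ x in Sᶜ, f x ∂μ := by
      have := integral_add_compl hS hfi
      linarith
    rw [h1, abs_neg, ← Real.norm_eq_abs]
    exact norm_setIntegral_le_of_norm_le_const (measure_lt_top _ _) fun x _ => hM x
  have hcompl : ∫ x in Sᶜ, f x ^ 2 ∂μ ≤ M ^ 2 * q := by
    refine (le_abs_self _).trans ?_
    rw [← Real.norm_eq_abs]
    refine norm_setIntegral_le_of_norm_le_const (measure_lt_top _ _) fun x _ => ?_
    rw [norm_pow]
    exact pow_le_pow_left₀ (norm_nonneg _) (hM x) 2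
  have hexp : ∫ x in S, (f x - m) ^ 2 ∂μ = ∫ x in S, f x ^ 2 ∂μ - 2 * m * a + m ^ 2 * (1 - q) := by
    have : ∀ x, (f x - m) ^ 2 = f x ^ 2 - 2 * m * f x + m ^ 2 := fun x => by ring
    simp_rw [this]
    have hfi' : IntegrableOn (fun x => 2 * m * f x) S μ := (hfi.const_mul _).integrableOn
    have hsub : IntegrableOn (fun x => f x ^ 2 - 2 * m * f x) S μ := hf2.integrableOn.sub hfi'
    rw [integral_add hsub (integrable_const _), integral_sub hf2.integrableOn hfi',
      integral_const_mul, setIntegral_const, hp, smul_eq_mul]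
    ring
  rw [← integral_add_compl hS hf2]
  have ha2 : a ^ 2 ≤ M ^ 2 * q ^ 2 := by
    rw [← sq_abs, ← mul_pow]
    exact pow_le_pow_left₀ (abs_nonneg _) ha_compl 2
  have hkey : 2 * m * a - m ^ 2 * (1 - q) + M ^ 2 * q ≤ s * M ^ 2 := by
    refine le_of_mul_le_mul_left ?_ hp0
    nlinarith [sq_nonneg (m * (1 - q) - a), mul_le_mul_of_nonneg_left hqs (sq_nonneg M)]
  linarith

theorem exists_muV_compl_ball_le {d : ℕ} {V : Ed d → ℝ}
    (hVint : Integrable (fun x => Real.exp (-V x))) {s : ℝ} (hs : 0 < s) :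
    ∃ r : ℝ, 1 < r ∧ muV d V ((ball (0 : Ed d) r)ᶜ) ≤ ENNReal.ofReal (s / (1 + s)) := by
  have := isProbabilityMeasure_muV hVint
  have hlim := tendsto_measure_compl_closedBall_of_isTightMeasureSet
    (isTightMeasureSet_singleton (μ := muV d V)) 0
  simp only [mem_singleton_iff, iSup_iSup_eq_left] at hlim
  have hpos : 0 < ENNReal.ofReal (s / (1 + s)) := by simpa using by positivity
  obtain ⟨r, hr1, hr⟩ := ((eventually_gt_atTop 1).and (hlim.eventually_le_const hpos)).exists
  refine ⟨r + 1, by linarith, (measure_mono ?_).trans hr⟩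
  exact compl_subset_compl.2 (closedBall_subset_ball (lt_add_one r))

/-- weak Poincaré inequality for `𝓔_{α,V}`. -/
theorem weak_poincare_formE
    (d : ℕ) (hd : 1 ≤ d) (α : ℝ) (hα : 0 < α ∧ α < 2)
    (V : Ed d → ℝ) (hVmeas : Measurable V) (hVloc : LocallyBounded d V)
    (hVint : Integrable (fun x => Real.exp (-V x))) :
    ∃ C₅ : ℝ, 0 < C₅ ∧ ∀ s : ℝ, 0 < s → ∀ f : Ed d → ℝ, CbSmooth d f →
      (∫ x, f x ∂(muV d V)) = 0 →
      ∫ x, (f x) ^ 2 ∂(muV d V) ≤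
        C₅ * alpha1 d V s * formE d α V f + s * (⨆ x : Ed d, |f x|) ^ 2 := by
  have := isProbabilityMeasure_muV hVint
  have hv1 : 0 < volume.real (ball (0 : Ed d) 1) :=
    ENNReal.toReal_pos (measure_ball_pos _ _ one_pos).ne' measure_ball_lt_top.ne
  refine ⟨2 * 3 ^ (d + 2) / volume.real (ball (0 : Ed d) 1), by positivity,
    fun s hs f hf hmean => ?_⟩
  set C := 2 * 3 ^ (d + 2) / volume.real (ball (0 : Ed d) 1)
  have hC0 : 0 < C := by positivity
  have hbound : ∀ t ∈ (fun r : ℝ => r ^ (3 * d) * Kfun d V r / kfun d V r) ''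
      {r : ℝ | 1 < r ∧ muV d V ((ball (0 : Ed d) r)ᶜ) ≤ ENNReal.ofReal (s / (1 + s))},
      ∫ x, (f x) ^ 2 ∂(muV d V) ≤
        C * t * formE d α V f + s * (⨆ x : Ed d, |f x|) ^ 2 := by
    rintro _ ⟨r, ⟨hr, hrs⟩, rfl⟩
    obtain ⟨m, hm⟩ := exists_setIntegral_sq_sub_le hd hα hVmeas hVloc hVint hf hr
    have := integral_sq_le_setIntegral_sq_sub_add hf.continuous.measurable
      (le_ciSup hf.bddAbove_abs) hmean (measurableSet_ball (x := 0) (ε := r)) hs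
      (ENNReal.toReal_le_of_le_ofReal (by positivity) hrs) m
    linarith
  have hne : ((fun r : ℝ => r ^ (3 * d) * Kfun d V r / kfun d V r) ''
      {r : ℝ | 1 < r ∧ muV d V ((ball (0 : Ed d) r)ᶜ) ≤ ENNReal.ofReal (s / (1 + s))}).Nonempty :=
    Set.Nonempty.image _ (exists_muV_compl_ball_le hVint hs)
  rcases (formE_nonneg d α V f).eq_or_lt with hE | hE
  · obtain ⟨t, ht⟩ := hne
    simpa [← hE] using hbound t ht
  · have hinf : (∫ x, (f x) ^ 2 ∂(muV d V) - s * (⨆ x : Ed d, |f x|) ^ 2) /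
        (C * formE d α V f) ≤ alpha1 d V s := by
      refine le_csInf hne fun t ht => ?_
      rw [div_le_iff₀ (by positivity)]
      linarith [hbound t ht]
    rw [div_le_iff₀ (by positivity)] at hinf
    linarith
end
end

section
/- Let φ : ℝ^d → ℝ be continuous with φ > 1 everywhere and φ(x) = e^{|x|} for |x| > 1. Suppose that liminf_{|x|→∞} [ inf_{z: |x|−1 ≤ |z| ≤ |x|−1/2} e^{−V(z)} ] / [ sup_{z: |x| ≤ |z| ≤ |x|+1} e^{−V(z)} ] > (1/α)·2^{2d+1}·(e + e^{1/2})·(2^α − 1). Then there exist positive constants C₁, b and r₀ > 2 such that L̃_{α,V}φ(x) ≤ −C₁ ( e^{V(x)} · inf_{z: |x|−1 ≤ |z| ≤ |x|−1/2} e^{−V(z)} ) φ(x) for every x with |x| ≥ r₀, and |L̃_{α,V}φ(x)| ≤ b for every x with |x| < r₀ (equivalently, L̃_{α,V}φ(x) ≤ −C₁ ( e^{V(x)} inf_{z: |x|−1 ≤ |z| ≤ |x|−1/2} e^{−V(z)} ) φ(x) + b·𝟙_{B(0,r₀)}(x) on ℝ^d). -/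
open MeasureTheory Real Set Metric Filter

noncomputable section

/-- The generator `L̃_{α,V}` of the truncated Dirichlet form, acting on continuous `φ`. -/
def tildeL (d : ℕ) (α : ℝ) (V φ : Ed d → ℝ) (x : Ed d) : ℝ :=
  (1/2) * ∫ y in {y : Ed d | 1/2 ≤ dist x y ∧ dist x y ≤ 1},
    (φ y - φ x) * (1 + Real.exp (V x - V y)) / dist x y ^ ((d:ℝ) + α)

/-- The set of points `y` with `1/2 ≤ |x - y| ≤ 1`. -/
def shell (d : ℕ) (x : Ed d) : Set (Ed d) :=
  {y : Ed d | 1/2 ≤ dist x y ∧ dist x y ≤ 1}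

/-- The integrand of `tildeL`. -/
def tildeLIntegrand (d : ℕ) (α : ℝ) (V φ : Ed d → ℝ) (x y : Ed d) : ℝ :=
  (φ y - φ x) * (1 + Real.exp (V x - V y)) / dist x y ^ ((d:ℝ) + α)

/-- The part of the closed ball `closedBall p s` in the half space `⟪y - p, e⟫ ≤ 0`. -/
def halfBall (d : ℕ) (p e : Ed d) (s : ℝ) : Set (Ed d) :=
  {y : Ed d | ‖y - p‖ ≤ s ∧ inner ℝ (y - p) e ≤ 0}

lemma one_sub_exp_neg_half_pos : 0 < 1 - Real.exp (-(1/2)) :=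
  sub_pos.mpr (Real.exp_lt_one_iff.mpr (by norm_num))

lemma measurableSet_shell (d : ℕ) (x : Ed d) : MeasurableSet (shell d x) := by
  have h1 : IsClosed {y : Ed d | 1/2 ≤ dist x y} := isClosed_le (by fun_prop) (by fun_prop)
  have h2 : IsClosed {y : Ed d | dist x y ≤ 1} := isClosed_le (by fun_prop) (by fun_prop)
  exact (h1.inter h2).measurableSet

lemma shell_subset_closedBall (d : ℕ) (x : Ed d) : shell d x ⊆ closedBall x 1 := by
  intro y hy
  rw [mem_closedBall, dist_comm]
  exact hy.2

lemma volume_shell_ne_top (d : ℕ) (x : Ed d) : volume (shell d x) ≠ ⊤ :=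
  ((measure_mono (shell_subset_closedBall d x)).trans_lt measure_closedBall_lt_top).ne

lemma measurableSet_halfBall (d : ℕ) (p e : Ed d) (s : ℝ) : MeasurableSet (halfBall d p e s) := by
  have h1 : IsClosed {y : Ed d | ‖y - p‖ ≤ s} := isClosed_le (by fun_prop) (by fun_prop)
  have h2 : IsClosed {y : Ed d | inner ℝ (y - p) e ≤ 0} := isClosed_le (by fun_prop) (by fun_prop)
  exact (h1.inter h2).measurableSet

lemma halfBall_subset_closedBall (d : ℕ) (p e : Ed d) (s : ℝ) :
    halfBall d p e s ⊆ closedBall p s := by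
  intro y hy
  rw [mem_closedBall, dist_eq_norm]
  exact hy.1

lemma volume_real_halfBall_ge (d : ℕ) (p e : Ed d) {s : ℝ} (hs : 0 ≤ s) :
    s ^ d / 2 * volume.real (ball (0 : Ed d) 1) ≤ volume.real (halfBall d p e s) := by
  have hfin : volume (halfBall d p e s) ≠ ⊤ :=
    ((measure_mono (halfBall_subset_closedBall d p e s)).trans_lt measure_closedBall_lt_top).ne
  have hpres := Measure.measurePreserving_sub_left (volume : Measure (Ed d)) (p + p)
  have heq : volume ((fun y => p + p - y) ⁻¹' halfBall d p e s) = volume (halfBall d p e s) :=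
    hpres.measure_preimage (measurableSet_halfBall d p e s).nullMeasurableSet
  have hcover : closedBall p s ⊆
      halfBall d p e s ∪ (fun y => p + p - y) ⁻¹' halfBall d p e s := by
    intro y hy
    rw [mem_closedBall, dist_eq_norm] at hy
    have hneg : p + p - y - p = -(y - p) := by abel
    rcases le_total (inner ℝ (y - p) e) 0 with h | h
    · exact Or.inl ⟨hy, h⟩
    · refine Or.inr ⟨?_, ?_⟩
      · simpa only [hneg, norm_neg] using hy
      · simpa only [hneg, inner_neg_left, neg_nonpos] using h
  have h1 := measureReal_mono (μ := volume) hcover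
    (measure_union_ne_top hfin (by rw [heq]; exact hfin))
  have h2 := measureReal_union_le (μ := volume) (halfBall d p e s)
    ((fun y => p + p - y) ⁻¹' halfBall d p e s)
  have h3 : volume.real ((fun y => p + p - y) ⁻¹' halfBall d p e s) =
      volume.real (halfBall d p e s) := by rw [measureReal_def, heq, measureReal_def]
  have h4 := Measure.addHaar_real_closedBall (volume : Measure (Ed d)) p hs
  rw [finrank_euclideanSpace_fin] at h4
  linarith

lemma integral_shell (d : ℕ) (hd : 1 ≤ d) {α : ℝ} (hα : 0 < α) (x : Ed d) :
    ∫ y in shell d x, (dist x y ^ ((d:ℝ) + α))⁻¹ =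
      d * volume.real (ball (0 : Ed d) 1) * ((2 ^ α - 1) / α) := by
  have : Nonempty (Fin d) := ⟨⟨0, hd⟩⟩
  have : Nontrivial (Ed d) := inferInstance
  let f : ℝ → ℝ := (Icc (1/2) 1).indicator fun t => (t ^ ((d:ℝ) + α))⁻¹
  have h1 : ∫ y in shell d x, (dist x y ^ ((d:ℝ) + α))⁻¹ = ∫ y : Ed d, f ‖y‖ := by
    rw [← integral_sub_left_eq_self (fun y : Ed d => f ‖y‖) volume x,
      ← integral_indicator (measurableSet_shell d x)]
    congr 1
  have h2 : ∫ t in Ioi (0:ℝ), t ^ (d - 1) • f t = (2 ^ α - 1) / α := by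
    have h3 : ∀ t : ℝ, t ^ (d - 1) • f t =
        (Icc (1/2) 1).indicator (fun t : ℝ => t ^ (-1 - α)) t := by
      intro t
      by_cases ht : t ∈ Icc (1/2 : ℝ) 1
      · have ht0 : 0 < t := by linarith [ht.1]
        simp only [f, indicator_of_mem ht, smul_eq_mul]
        rw [← Real.rpow_neg ht0.le, ← Real.rpow_natCast, ← Real.rpow_add ht0]
        congr 1
        push_cast [hd]
        ring
      · simp only [f, indicator_of_notMem ht, smul_zero]
    simp_rw [h3]
    have hsub : Ioi (0:ℝ) ∩ Icc (1/2) 1 = Icc (1/2) 1 :=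
      inter_eq_right.mpr fun t ht => by
        have := ht.1
        exact lt_of_lt_of_le (by norm_num) this
    rw [setIntegral_indicator measurableSet_Icc, hsub, integral_Icc_eq_integral_Ioc,
      ← intervalIntegral.integral_of_le (by norm_num), integral_rpow]
    · have h4 : (1/2 : ℝ) ^ (-1 - α + 1) = 2 ^ α := by
        rw [one_div, Real.inv_rpow (by norm_num), ← Real.rpow_neg (by norm_num)]
        congr 1
        ring
      rw [h4, Real.one_rpow, show -1 - α + 1 = -α by ring, div_neg, ← neg_div, neg_sub]
    · right
      refine ⟨by linarith, ?_⟩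
      rw [uIcc_of_le (by norm_num)]
      intro h
      have := h.1
      norm_num at this
  rw [h1, integral_fun_norm_addHaar, finrank_euclideanSpace_fin, h2]
  simp only [nsmul_eq_mul, smul_eq_mul]
  ring

/-- A half ball of radius `1/2 - δ` sits in the shell around `x`, inside the ball of radius
`‖x‖ - 1/2`, as soon as `‖x‖` is large compared to `1/δ`. -/
lemma halfBall_subset (d : ℕ) {δ : ℝ} (hδ : 0 < δ) (hδ' : δ < 1/2) {x : Ed d}
    (hx : 1 + 1 / δ ≤ ‖x‖) :
    ∀ y ∈ halfBall d (x - (1/2 + δ) • (‖x‖⁻¹ • x)) (‖x‖⁻¹ • x) (1/2 - δ),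
      y ∈ shell d x ∧ ‖y‖ ≤ ‖x‖ - 1/2 := by
  intro y hy
  have hδi : 0 < 1 / δ := by positivity
  have hx0 : 0 < ‖x‖ := by linarith
  have hδx : 1 ≤ δ * (‖x‖ - 1/2) := by
    have : δ * (1 / δ) = 1 := by field_simp
    nlinarith
  set e := ‖x‖⁻¹ • x with he
  have hen : ‖e‖ = 1 := by
    rw [he, norm_smul, norm_inv, norm_norm, inv_mul_cancel₀ hx0.ne']
  have hxe : x = ‖x‖ • e := by
    rw [he, smul_smul, mul_inv_cancel₀ hx0.ne', one_smul]
  obtain ⟨hk, hke⟩ := hy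
  set k := y - (x - (1/2 + δ) • e) with hkdef
  have hxy : x - y = (1/2 + δ) • e - k := by rw [hkdef]; abel
  have hy' : y = (‖x‖ - 1/2 - δ) • e + k := by
    have : (‖x‖ - 1/2 - δ) • e = x - (1/2 + δ) • e := by
      conv_rhs => rw [hxe]
      rw [← sub_smul]
      congr 1
      ring
    rw [this, hkdef]; abel
  have hk0 := norm_nonneg k
  have hd2 : dist x y ^ 2 = (1/2 + δ) ^ 2 - 2 * (1/2 + δ) * inner ℝ k e + ‖k‖ ^ 2 := by
    rw [dist_eq_norm, hxy, norm_sub_sq_real, norm_smul, hen, inner_smul_left,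
      real_inner_comm, Real.norm_eq_abs, mul_one, sq_abs]
    simp
    ring
  have hy2 : ‖y‖ ^ 2 = (‖x‖ - 1/2 - δ) ^ 2 + 2 * (‖x‖ - 1/2 - δ) * inner ℝ k e + ‖k‖ ^ 2 := by
    conv_lhs => rw [hy']
    rw [norm_add_sq_real, norm_smul, hen, inner_smul_left,
      real_inner_comm, Real.norm_eq_abs, mul_one, sq_abs]
    simp
    ring
  refine ⟨⟨?_, ?_⟩, ?_⟩
  · refine le_of_sq_le_sq ?_ dist_nonneg
    nlinarith
  · rw [dist_eq_norm, hxy]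
    refine (norm_sub_le _ _).trans ?_
    rw [norm_smul, hen, Real.norm_eq_abs, abs_of_pos (by linarith)]
    linarith
  · have hpos : 0 ≤ ‖x‖ - 1/2 - δ := by nlinarith
    refine le_of_sq_le_sq ?_ (by linarith)
    rw [hy2]
    have h1 : ‖k‖ ^ 2 ≤ (1/2 - δ) ^ 2 := by gcongr
    have h2 : (‖x‖ - 1/2 - δ) * inner ℝ k e ≤ 0 := mul_nonpos_of_nonneg_of_nonpos hpos hke
    nlinarith

lemma exists_bound_tildeLIntegrand (d : ℕ) {α : ℝ} (hα : 0 < α) {V φ : Ed d → ℝ}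
    (hV : LocallyBounded d V) (hφ : Continuous φ) (r : ℝ) :
    ∃ B : ℝ, 0 < B ∧ ∀ x : Ed d, ‖x‖ ≤ r → ∀ y ∈ shell d x, ‖tildeLIntegrand d α V φ x y‖ ≤ B := by
  obtain ⟨M, hM⟩ := hV (r + 1)
  obtain ⟨N, hN⟩ := (isCompact_closedBall (0 : Ed d) (r + 1)).exists_bound_of_continuousOn
    hφ.continuousOn
  refine ⟨(|N| + |N|) * (1 + Real.exp (|M| + |M|)) / (1/2 : ℝ) ^ ((d:ℝ) + α) + 1,
    by positivity, ?_⟩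
  intro x hx y hy
  have hyn : ‖y‖ ≤ r + 1 := by
    have h1 := norm_sub_norm_le y x
    have h2 := hy.2
    rw [dist_comm, dist_eq_norm] at h2
    linarith
  have hxn : ‖x‖ ≤ r + 1 := by linarith
  have hφx := (hN x (by simpa using hxn)).trans (le_abs_self N)
  have hφy := (hN y (by simpa using hyn)).trans (le_abs_self N)
  have hVx := (hM x hxn).trans (le_abs_self M)
  have hVy := (hM y hyn).trans (le_abs_self M)
  rw [abs_le] at hVx hVy
  have hK : (1/2 : ℝ) ^ ((d:ℝ) + α) ≤ dist x y ^ ((d:ℝ) + α) :=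
    Real.rpow_le_rpow (by norm_num) hy.1 (by positivity)
  refine le_trans ?_ (le_add_of_nonneg_right zero_le_one)
  rw [tildeLIntegrand, norm_div, norm_mul, Real.norm_of_nonneg (r := 1 + _) (by positivity),
    Real.norm_of_nonneg (r := _ ^ _) (by positivity)]
  gcongr
  · exact (norm_sub_le _ _).trans (add_le_add hφy hφx)
  · linarith

lemma measurable_tildeLIntegrand (d : ℕ) (α : ℝ) {V φ : Ed d → ℝ}
    (hV : Measurable V) (hφ : Continuous φ) (x : Ed d) :
    Measurable (tildeLIntegrand d α V φ x) := by
  have := hφ.measurable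
  unfold tildeLIntegrand
  fun_prop

lemma integrableOn_tildeLIntegrand (d : ℕ) {α : ℝ} (hα : 0 < α) {V φ : Ed d → ℝ}
    (hVm : Measurable V) (hV : LocallyBounded d V) (hφ : Continuous φ) (x : Ed d) :
    IntegrableOn (tildeLIntegrand d α V φ x) (shell d x) := by
  obtain ⟨B, -, hB⟩ := exists_bound_tildeLIntegrand d hα hV hφ ‖x‖
  refine Measure.integrableOn_of_bounded (M := B) (volume_shell_ne_top d x)
    (measurable_tildeLIntegrand d α hVm hφ x).aestronglyMeasurable ?_
  filter_upwards [ae_restrict_mem (measurableSet_shell d x)] with y hy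
  exact hB x le_rfl y hy

lemma integrableOn_shell_kernel (d : ℕ) {α : ℝ} (hα : 0 < α) (x : Ed d) :
    IntegrableOn (fun y => (dist x y ^ ((d:ℝ) + α))⁻¹) (shell d x) := by
  refine Measure.integrableOn_of_bounded (M := ((1/2 : ℝ) ^ ((d:ℝ) + α))⁻¹)
    (volume_shell_ne_top d x)
    (Measurable.aestronglyMeasurable (by fun_prop)) ?_
  filter_upwards [ae_restrict_mem (measurableSet_shell d x)] with y hy
  rw [Real.norm_of_nonneg (by positivity)]
  have := Real.rpow_le_rpow (z := (d:ℝ) + α) (by norm_num) hy.1 (by positivity)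
  gcongr

lemma exp_neg_le_supAnn (d : ℕ) {V : Ed d → ℝ} (hV : LocallyBounded d V) {x z : Ed d}
    (h1 : ‖x‖ ≤ ‖z‖) (h2 : ‖z‖ ≤ ‖x‖ + 1) : Real.exp (-V z) ≤ supAnn d V x := by
  obtain ⟨M, hM⟩ := hV (‖x‖ + 1)
  refine le_csSup ⟨Real.exp M, ?_⟩ ⟨z, ⟨h1, h2⟩, rfl⟩
  rintro _ ⟨w, hw, rfl⟩
  exact Real.exp_le_exp.mpr (by linarith [(abs_le.mp (hM w hw.2)).1])

lemma infAnn_le_exp_neg (d : ℕ) {V : Ed d → ℝ} {x z : Ed d}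
    (h1 : ‖x‖ - 1 ≤ ‖z‖) (h2 : ‖z‖ ≤ ‖x‖ - 1/2) : infAnn d V x ≤ Real.exp (-V z) := by
  refine csInf_le ⟨0, ?_⟩ ⟨z, ⟨h1, h2⟩, rfl⟩
  rintro _ ⟨w, -, rfl⟩
  exact (Real.exp_pos _).le

lemma supAnn_pos (d : ℕ) {V : Ed d → ℝ} (hV : LocallyBounded d V) (x : Ed d) :
    0 < supAnn d V x :=
  (Real.exp_pos _).trans_le (exp_neg_le_supAnn d hV (le_refl ‖x‖) (by linarith))

/-- Pointwise upper bound for the integrand of `tildeL`, separating the outward jumps from the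
inward jumps into a set `H`. -/
lemma tildeLIntegrand_le (d : ℕ) {α : ℝ} (hα : 0 < α) {V φ : Ed d → ℝ}
    (hV : LocallyBounded d V) (hφexp : ∀ x : Ed d, 1 < ‖x‖ → φ x = Real.exp ‖x‖)
    {x y : Ed d} (hx : 2 < ‖x‖) (hI : 0 ≤ infAnn d V x) (hy : y ∈ shell d x)
    {H : Set (Ed d)} (hH : y ∈ H → ‖y‖ ≤ ‖x‖ - 1/2) :
    tildeLIntegrand d α V φ x y ≤
      Real.exp ‖x‖ * Real.exp (V x) * (2 * (Real.exp 1 - 1) * supAnn d V x) *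
          (dist x y ^ ((d:ℝ) + α))⁻¹ -
        H.indicator (fun _ => Real.exp ‖x‖ * Real.exp (V x) *
          ((1 - Real.exp (-(1/2))) * infAnn d V x)) y := by
  have hS := supAnn_pos d hV x
  have he1 : 0 < Real.exp 1 - 1 := by linarith [Real.add_one_lt_exp (one_ne_zero (α := ℝ))]
  have heh := one_sub_exp_neg_half_pos
  have hdist : |‖x‖ - ‖y‖| ≤ 1 :=
    (abs_norm_sub_norm_le x y).trans (by rw [← dist_eq_norm]; exact hy.2)
  rw [abs_le] at hdist
  have hd0 : 0 < dist x y := by linarith [hy.1]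
  have hK1 : 1 ≤ (dist x y ^ ((d:ℝ) + α))⁻¹ :=
    (one_le_inv₀ (by positivity)).mpr (Real.rpow_le_one hd0.le hy.2 (by positivity))
  have hsplit : Real.exp (V x - V y) = Real.exp (V x) * Real.exp (-V y) := by
    rw [← Real.exp_add]; rfl
  rw [tildeLIntegrand, hφexp x (by linarith), hφexp y (by linarith), div_eq_mul_inv]
  set K := (dist x y ^ ((d:ℝ) + α))⁻¹
  have hP : 0 ≤ Real.exp ‖x‖ * Real.exp (V x) * (2 * (Real.exp 1 - 1) * supAnn d V x) * K := by
    positivity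
  by_cases hyH : y ∈ H
  · rw [indicator_of_mem hyH]
    have hyn := hH hyH
    have h1 : Real.exp ‖y‖ ≤ Real.exp ‖x‖ * Real.exp (-(1/2)) := by
      rw [← Real.exp_add]
      exact Real.exp_le_exp.mpr (by linarith)
    have h2 : Real.exp (V x) * infAnn d V x ≤ 1 + Real.exp (V x - V y) := by
      rw [hsplit]
      have := mul_le_mul_of_nonneg_left
        (infAnn_le_exp_neg d (V := V) (x := x) (z := y) (by linarith) hyn) (Real.exp_pos (V x)).le
      linarith
    have h3 : Real.exp ‖x‖ * (1 - Real.exp (-(1/2))) ≤ Real.exp ‖x‖ - Real.exp ‖y‖ := by linarith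
    have h4 : Real.exp ‖x‖ * (1 - Real.exp (-(1/2))) * (Real.exp (V x) * infAnn d V x) * 1 ≤
        (Real.exp ‖x‖ - Real.exp ‖y‖) * (1 + Real.exp (V x - V y)) * K := by
      have : 0 ≤ Real.exp ‖x‖ - Real.exp ‖y‖ := le_trans (by positivity) h3
      gcongr
    linarith
  · rw [indicator_of_notMem hyH, sub_zero]
    rcases le_total ‖y‖ ‖x‖ with hyx | hyx
    · refine le_trans ?_ hP
      refine mul_nonpos_of_nonpos_of_nonneg (mul_nonpos_of_nonpos_of_nonneg ?_ (by positivity))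
        (by positivity)
      exact sub_nonpos.mpr (Real.exp_le_exp.mpr hyx)
    · have h1 : Real.exp ‖y‖ - Real.exp ‖x‖ ≤ Real.exp ‖x‖ * (Real.exp 1 - 1) := by
        have : Real.exp ‖y‖ ≤ Real.exp ‖x‖ * Real.exp 1 := by
          rw [← Real.exp_add]
          exact Real.exp_le_exp.mpr (by linarith)
        linarith
      have h2 : 1 + Real.exp (V x - V y) ≤ Real.exp (V x) * (2 * supAnn d V x) := by
        have h3 : Real.exp (V x) * Real.exp (-V x) = 1 := by
          rw [← Real.exp_add, add_neg_cancel, Real.exp_zero]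
        have h4 := mul_le_mul_of_nonneg_left
          (exp_neg_le_supAnn d hV (le_refl ‖x‖) (by linarith)) (Real.exp_pos (V x)).le
        have h5 := mul_le_mul_of_nonneg_left
          (exp_neg_le_supAnn d hV hyx (by linarith)) (Real.exp_pos (V x)).le
        rw [hsplit]
        linarith
      calc _ ≤ Real.exp ‖x‖ * (Real.exp 1 - 1) * (Real.exp (V x) * (2 * supAnn d V x)) * K := by
            gcongr
        _ = _ := by ring

lemma tildeL_le (d : ℕ) (hd : 1 ≤ d) {α : ℝ} (hα : 0 < α) {V φ : Ed d → ℝ}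
    (hVm : Measurable V) (hV : LocallyBounded d V) (hφ : Continuous φ)
    (hφexp : ∀ x : Ed d, 1 < ‖x‖ → φ x = Real.exp ‖x‖) {δ : ℝ} (hδ : 0 < δ) (hδ' : δ < 1/2)
    {x : Ed d} (hx : 2 < ‖x‖) (hxδ : 1 + 1 / δ ≤ ‖x‖) (hI : 0 ≤ infAnn d V x) :
    tildeL d α V φ x ≤ (1/2) * (Real.exp ‖x‖ * Real.exp (V x) *
      volume.real (ball (0 : Ed d) 1) *
      (2 * (Real.exp 1 - 1) * supAnn d V x * (d * ((2 ^ α - 1) / α)) -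
        (1 - Real.exp (-(1/2))) * infAnn d V x * ((1/2 - δ) ^ d / 2))) := by
  have hsub := halfBall_subset d hδ hδ' hxδ
  have hvol := volume_real_halfBall_ge d (x - (1/2 + δ) • (‖x‖⁻¹ • x)) (‖x‖⁻¹ • x)
    (s := 1/2 - δ) (by linarith)
  have hHm := measurableSet_halfBall d (x - (1/2 + δ) • (‖x‖⁻¹ • x)) (‖x‖⁻¹ • x) (1/2 - δ)
  set H := halfBall d (x - (1/2 + δ) • (‖x‖⁻¹ • x)) (‖x‖⁻¹ • x) (1/2 - δ)
  have heh := one_sub_exp_neg_half_pos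
  set c := Real.exp ‖x‖ * Real.exp (V x) * ((1 - Real.exp (-(1/2))) * infAnn d V x) with hc
  have hc0 : 0 ≤ c := by positivity
  have hKint := (integrableOn_shell_kernel d hα x).const_mul
    (Real.exp ‖x‖ * Real.exp (V x) * (2 * (Real.exp 1 - 1) * supAnn d V x))
  have hHint : IntegrableOn (H.indicator fun _ => c) (shell d x) :=
    IntegrableOn.indicator (integrableOn_const (volume_shell_ne_top d x)) hHm
  have hmono := setIntegral_mono_on (integrableOn_tildeLIntegrand d hα hVm hV hφ x)
    (hKint.sub hHint) (measurableSet_shell d x)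
    (fun y hy => tildeLIntegrand_le d hα hV hφexp hx hI hy fun h => (hsub y h).2)
  have hint : ∫ y in shell d x, H.indicator (fun _ => c) y = c * volume.real H := by
    rw [setIntegral_indicator hHm, inter_eq_right.mpr fun y hy => (hsub y hy).1,
      setIntegral_const, smul_eq_mul, mul_comm]
  simp only [Pi.sub_apply] at hmono
  rw [integral_sub hKint hHint, integral_const_mul, integral_shell d hd hα, hint] at hmono
  have hcH := mul_le_mul_of_nonneg_left hvol hc0
  have hL : tildeL d α V φ x = (1/2) * ∫ y in shell d x, tildeLIntegrand d α V φ x y := rfl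
  rw [hL]
  refine mul_le_mul_of_nonneg_left ?_ (by norm_num)
  calc _ ≤ _ := hmono
    _ ≤ _ := sub_le_sub_left hcH _
    _ = _ := by rw [hc]; ring

lemma thresholdConst_pos (d : ℕ) {α : ℝ} (hα : 0 < α) : 0 < thresholdConst d α := by
  have : 1 < (2:ℝ) ^ α := Real.one_lt_rpow (by norm_num) hα
  have : 0 < (2:ℝ) ^ α - 1 := by linarith
  unfold thresholdConst
  positivity

/-- Past the threshold, inward jumps dominate outward jumps for all small enough `δ`. -/
lemma exists_delta (d : ℕ) (hd : 1 ≤ d) {α c : ℝ} (hα : 0 < α) (hc : thresholdConst d α < c) :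
    ∃ δ : ℝ, 0 < δ ∧ δ < 1/2 ∧
      2 * (Real.exp 1 - 1) * (d * ((2 ^ α - 1) / α)) / c <
        (1 - Real.exp (-(1/2))) * ((1/2 - δ) ^ d / 2) := by
  have hT := thresholdConst_pos d hα
  have hc0 : 0 < c := hT.trans hc
  have hzero : 2 * (Real.exp 1 - 1) * (d * ((2 ^ α - 1) / α)) / c <
      (1 - Real.exp (-(1/2))) * ((1/2 - 0) ^ d / 2) := by
    have heh := one_sub_exp_neg_half_pos
    have hexp : Real.exp 1 - 1 =
        (1 - Real.exp (-(1/2))) * (Real.exp 1 + Real.exp (1/2)) := by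
      have h1 : Real.exp (-(1/2)) * Real.exp (1/2) = 1 := by
        rw [← Real.exp_add]; norm_num
      have h2 : Real.exp (-(1/2)) * Real.exp 1 = Real.exp (1/2) := by
        rw [← Real.exp_add]; norm_num
      linear_combination h1 + h2
    have hdpow : (d : ℝ) ≤ 2 ^ (d - 1) := by
      have : d ≤ 2 ^ (d - 1) := by
        have := Nat.lt_two_pow_self (n := d - 1)
        omega
      exact_mod_cast this
    have hpow : (2:ℝ) ^ d = 2 * 2 ^ (d - 1) := by
      rw [← pow_succ', Nat.sub_add_cancel hd]
    have hLHS : 2 * (Real.exp 1 - 1) * (d * ((2 ^ α - 1) / α)) =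
        (1 - Real.exp (-(1/2))) * (d / (2 ^ d) ^ 2) * thresholdConst d α := by
      rw [hexp, thresholdConst, pow_succ (2:ℝ) (2 * d), mul_comm 2 d, pow_mul]
      field_simp
    rw [hLHS, div_lt_iff₀ hc0]
    have hfrac : (d : ℝ) / (2 ^ d) ^ 2 ≤ (1/2 - 0) ^ d / 2 := by
      rw [sub_zero, one_div, inv_pow, div_le_iff₀ (by positivity)]
      have h2d : (2:ℝ) ^ d ≠ 0 := by positivity
      calc (d : ℝ) ≤ 2 ^ (d - 1) := hdpow
        _ = 2 ^ d / 2 := by rw [hpow]; ring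
        _ = _ := by field_simp
    have hq : 0 < (1/2 - 0 : ℝ) ^ d / 2 := by positivity
    calc _ ≤ (1 - Real.exp (-(1/2))) * ((1/2 - 0) ^ d / 2) * thresholdConst d α := by gcongr
      _ < _ := by gcongr
  have hcont : Continuous fun δ : ℝ => (1 - Real.exp (-(1/2))) * ((1/2 - δ) ^ d / 2) := by
    fun_prop
  have hev := (hcont.continuousAt (x := 0)).eventually (lt_mem_nhds hzero)
  obtain ⟨ε, hε, hball⟩ := Metric.eventually_nhds_iff.mp hev
  refine ⟨min (ε / 2) (1/4), by positivity, ?_, hball ?_⟩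
  · exact (min_le_right _ _).trans_lt (by norm_num)
  · rw [Real.dist_eq, sub_zero, abs_of_pos (by positivity)]
    exact (min_le_left _ _).trans_lt (by linarith)

/-- Lyapunov condition for `L̃_{α,V}` with the Lyapunov function
`φ(x) = e^{|x|}` (for `|x| > 1`), under the liminf condition on `V`. -/
theorem lyapunov_condition_tildeL
    (d : ℕ) (hd : 1 ≤ d) (α : ℝ) (hα : 0 < α ∧ α < 2)
    (V : Ed d → ℝ) (hVmeas : Measurable V) (hVloc : LocallyBounded d V)
    (hVint : Integrable (fun x => Real.exp (-V x)))
    (φ : Ed d → ℝ) (hφ : Continuous φ) (hφ1 : ∀ x, 1 < φ x)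
    (hφexp : ∀ x : Ed d, 1 < ‖x‖ → φ x = Real.exp ‖x‖)
    (hliminf : ∃ c : ℝ, thresholdConst d α < c ∧
      ∃ R : ℝ, ∀ x : Ed d, R ≤ ‖x‖ → c ≤ infAnn d V x / supAnn d V x) :
    ∃ C₁ b r₀ : ℝ, 0 < C₁ ∧ 0 < b ∧ 2 < r₀ ∧
      (∀ x : Ed d, r₀ ≤ ‖x‖ →
        tildeL d α V φ x ≤ -C₁ * (Real.exp (V x) * infAnn d V x) * φ x) ∧
      (∀ x : Ed d, ‖x‖ < r₀ → |tildeL d α V φ x| ≤ b) := by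
  obtain ⟨hα0, -⟩ := hα
  obtain ⟨c, hc, R, hR⟩ := hliminf
  have hc0 : 0 < c := (thresholdConst_pos d hα0).trans hc
  obtain ⟨δ, hδ, hδ', hgap⟩ := exists_delta d hd hα0 hc
  set κ := (1 - Real.exp (-(1/2))) * ((1/2 - δ) ^ d / 2) -
    2 * (Real.exp 1 - 1) * (d * ((2 ^ α - 1) / α)) / c with hκ
  have hκ0 : 0 < κ := sub_pos.mpr hgap
  have hω : 0 < volume.real (ball (0 : Ed d) 1) :=
    ENNReal.toReal_pos (measure_ball_pos volume _ one_pos).ne' measure_ball_lt_top.ne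
  set ω := volume.real (ball (0 : Ed d) 1) with hωdef
  set r₀ := max R (max 3 (1 + 1 / δ))
  obtain ⟨B, hB0, hB⟩ := exists_bound_tildeLIntegrand d hα0 hVloc hφ r₀
  refine ⟨(1/2) * ω * κ, (1/2) * (B * ω), r₀, by positivity, by positivity, ?_, ?_, ?_⟩
  · have : (3:ℝ) ≤ r₀ := (le_max_left _ _).trans (le_max_right _ _)
    linarith
  · intro x hx
    have hxR : R ≤ ‖x‖ := (le_max_left _ _).trans hx
    have hx3 : 3 ≤ ‖x‖ := ((le_max_left _ _).trans (le_max_right _ _)).trans hx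
    have hxδ : 1 + 1 / δ ≤ ‖x‖ := ((le_max_right _ _).trans (le_max_right _ _)).trans hx
    have hS := supAnn_pos d hVloc x
    have hSI : supAnn d V x ≤ infAnn d V x / c := by
      rw [le_div_iff₀ hc0, mul_comm]
      exact (le_div_iff₀ hS).mp (hR x hxR)
    have hI : 0 ≤ infAnn d V x := by
      have := (div_pos_iff_of_pos_right hc0).mp (hS.trans_le hSI)
      exact this.le
    have he1 : 0 < Real.exp 1 - 1 := by
      linarith [Real.add_one_lt_exp (one_ne_zero (α := ℝ))]
    have h2α : 0 < (2:ℝ) ^ α - 1 := by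
      linarith [Real.one_lt_rpow (x := 2) (by norm_num) hα0]
    refine (tildeL_le d hd hα0 hVmeas hVloc hφ hφexp hδ hδ' (by linarith) hxδ hI).trans ?_
    rw [hφexp x (by linarith), ← hωdef]
    calc _ ≤ (1/2) * (Real.exp ‖x‖ * Real.exp (V x) * ω *
          (2 * (Real.exp 1 - 1) * (infAnn d V x / c) * (d * ((2 ^ α - 1) / α)) -
            (1 - Real.exp (-(1/2))) * infAnn d V x * ((1/2 - δ) ^ d / 2))) := by gcongr
      _ = _ := by rw [hκ]; ring
  · intro x hx
    have h1 := norm_setIntegral_le_of_norm_le_const (volume_shell_ne_top d x).lt_top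
      (hB x hx.le)
    have h2 : volume.real (shell d x) ≤ ω := by
      have h3 := measureReal_mono (μ := volume) (shell_subset_closedBall d x)
        measure_closedBall_lt_top.ne
      rwa [Measure.addHaar_real_closedBall volume x zero_le_one, one_pow, one_mul] at h3
    have hL : tildeL d α V φ x = (1/2) * ∫ y in shell d x, tildeLIntegrand d α V φ x y := rfl
    rw [hL, abs_mul, abs_of_pos (by norm_num : (0:ℝ) < 1/2), ← Real.norm_eq_abs]
    gcongr
    exact h1.trans (by gcongr)
end
end
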